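/- Fix d ≥ 2, an integer m ≥ 1, a subcube ω_i of the partition of Ω = [0,1]^d into m^d congruent subcubes, and any sequence of finite sets X_N ⊆ Ω with |X_N| ≤ N. Then the normalized difference between the TSP and boundary TSP on the subcube vanishes: lim_{N→∞} (T(X_N, ω_i) − T_B(X_N, ω_i)) / N^{(d-1)/d} = 0. -/

import Mathlib

open MeasureTheory Filter

noncomputable section

/-- The unit hypercube `Ω = [0,1]^d` in `ℝ^d`. -/
def unitCube (d : ℕ) : Set (EuclideanSpace ℝ (Fin d)) :=
  {x | ∀ i, x i ∈ Set.Icc (0 : ℝ) 1}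

/-- The subcube `ω_k` (for `k : Fin d → Fin m`) of the partition of `[0,1]^d` into `m^d`
congruent subcubes of edge length `1/m` (half-open, except closed at the top face). -/
def cell {d : ℕ} (m : ℕ) (k : Fin d → Fin m) : Set (EuclideanSpace ℝ (Fin d)) :=
  {x | ∀ i, x i ∈ (if (k i : ℕ) + 1 = m
      then Set.Icc ((k i : ℝ) / m) (((k i : ℝ) + 1) / m)
      else Set.Ico ((k i : ℝ) / m) (((k i : ℝ) + 1) / m))}

/-- Length of the polygonal path visiting the points of the list `l` in order,
for the distance function `ρ`. -/
def pathLen {E : Type*} (ρ : E → E → ℝ) (l : List E) : ℝ :=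
  (List.zipWith ρ l l.tail).sum

/-- Length of the closed tour visiting the points of the list `l` in order and coming back
to the starting point, for the distance function `ρ`. -/
def tourLen {E : Type*} (ρ : E → E → ℝ) (l : List E) : ℝ :=
  pathLen ρ (l ++ l.take 1)

/-- `l` enumerates the points of the set `F` (each exactly once). -/
def Enumerates {E : Type*} (l : List E) (F : Set E) : Prop :=
  l.Nodup ∧ ∀ z, z ∈ l ↔ z ∈ F

/-- `T F`: the length of the shortest Hamiltonian path through the (finite) set `F`,
i.e. the minimum over orderings of `F` of the sum of consecutive Euclidean distances. -/
def T {E : Type*} [PseudoMetricSpace E] (F : Set E) : ℝ :=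
  sInf {L | ∃ l : List E, Enumerates l F ∧ pathLen dist l = L}

/-- The pseudometric obtained from the Euclidean metric by identifying all points of the
boundary `∂R` of `R`: `d(a,b) = min(dist a b, dist(a,∂R) + dist(b,∂R))`. -/
def bdist {E : Type*} [PseudoMetricSpace E] (R : Set E) (a b : E) : ℝ :=
  min (dist a b) (Metric.infDist a (frontier R) + Metric.infDist b (frontier R))

/-- `TB F R`: the boundary TSP, i.e. the length of the shortest Hamiltonian tour through
`F ∩ R` for the pseudometric obtained from the Euclidean one by identifying the points of
the boundary `∂R` (travel along the boundary is free). -/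
def TB {E : Type*} [PseudoMetricSpace E] (F R : Set E) : ℝ :=
  sInf {L | ∃ l : List E, Enumerates l (F ∩ R) ∧ tourLen (bdist R) l = L}

/-- Cumulative length of the polygonal path through `l` up to its `(j+1)`-st point. -/
def cumLen {E : Type*} [PseudoMetricSpace E] (l : List E) (j : ℕ) : ℝ :=
  pathLen dist (l.take (j + 1))

/-- `γ` is the constant-speed parameterization, on `[0,1]`, of the polygonal curve joining
the consecutive points of `l`: it traverses the segment from `l[j]` to `l[j+1]` affinely on
the time interval `[cumLen l j / pathLen l, cumLen l (j+1) / pathLen l]`. -/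
def IsConstSpeedParam {d : ℕ} (l : List (EuclideanSpace ℝ (Fin d)))
    (γ : ℝ → EuclideanSpace ℝ (Fin d)) : Prop :=
  ∀ j : ℕ, ∀ h : j + 1 < l.length, ∀ u : ℝ, u ∈ Set.Icc (0 : ℝ) 1 →
    γ (((1 - u) * cumLen l j + u * cumLen l (j + 1)) / pathLen dist l)
      = (1 - u) • l[j]'(Nat.lt_of_succ_lt h) + u • l[j + 1]'h

/-- `restLen l γ B`: the one-dimensional length of the portion lying in `B` of the polygonal
curve through `l` parameterized at constant speed by `γ` on `[0,1]`; equivalently,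
`pathLen l` times the time spent in `B`. -/
def restLen {d : ℕ} (l : List (EuclideanSpace ℝ (Fin d)))
    (γ : ℝ → EuclideanSpace ℝ (Fin d)) (B : Set (EuclideanSpace ℝ (Fin d))) : ℝ :=
  pathLen dist l * (volume (γ ⁻¹' B ∩ Set.Icc (0 : ℝ) 1)).toReal

/-- The first `N` sample points `X_N = {x_1, …, x_N}` of the sequence `x` at sample `ω`. -/
def sampleSet {α Ω₀ : Type*} (x : ℕ → Ω₀ → α) (N : ℕ) (ω : Ω₀) : Set α :=
  (fun i => x i ω) '' Set.Iio N


open scoped Topology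

section combi
variable {E : Type*}

theorem pathLen_nil (ρ : E → E → ℝ) : pathLen ρ [] = 0 := by simp [pathLen]

theorem pathLen_single (ρ : E → E → ℝ) (a : E) : pathLen ρ [a] = 0 := by simp [pathLen]

theorem pathLen_cons2 (ρ : E → E → ℝ) (a b : E) (l : List E) :
    pathLen ρ (a :: b :: l) = ρ a b + pathLen ρ (b :: l) := by simp [pathLen]

theorem pathLen_append (ρ : E → E → ℝ) (l : List E) (a b : E) (r : List E) :
    pathLen ρ (l ++ a :: b :: r) = pathLen ρ (l ++ [a]) + ρ a b + pathLen ρ (b :: r) := by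
  induction l with
  | nil => simp [pathLen_cons2, pathLen_single]
  | cons c l ih =>
    cases l with
    | nil => simp [pathLen_cons2, pathLen_single]; ring
    | cons e l =>
      simp only [List.cons_append] at ih ⊢
      rw [pathLen_cons2, pathLen_cons2, ih]; ring

theorem pathLen_reverse (ρ : E → E → ℝ) (hs : ∀ a b, ρ a b = ρ b a) (l : List E) :
    pathLen ρ l.reverse = pathLen ρ l := by
  induction l with
  | nil => rfl
  | cons a l ih =>
    cases l with
    | nil => rfl
    | cons b l =>
      rw [pathLen_cons2, ← ih]
      simp only [List.reverse_cons, List.append_assoc, List.cons_append, List.nil_append]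
      rw [pathLen_append, pathLen_single, hs]; ring

theorem pathLen_mono (ρ σ : E → E → ℝ) (hs : ∀ a b, ρ a b ≤ σ a b) (l : List E) :
    pathLen ρ l ≤ pathLen σ l := by
  induction l with
  | nil => simp [pathLen_nil]
  | cons a l ih =>
    cases l with
    | nil => simp [pathLen_single]
    | cons b l => rw [pathLen_cons2, pathLen_cons2]; linarith [hs a b]

theorem pathLen_nonneg (ρ : E → E → ℝ) (hs : ∀ a b, 0 ≤ ρ a b) (l : List E) :
    0 ≤ pathLen ρ l := by
  induction l with
  | nil => simp [pathLen_nil]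
  | cons a l ih =>
    cases l with
    | nil => simp [pathLen_single]
    | cons b l => rw [pathLen_cons2]; linarith [hs a b]

theorem tourLen_cons (ρ : E → E → ℝ) (a : E) (l : List E) :
    ∃ b ∈ (a :: l), tourLen ρ (a :: l) = pathLen ρ (a :: l) + ρ b a := by
  rcases List.eq_nil_or_concat' (a :: l) with h | ⟨L, b, h⟩
  · simp at h
  · refine ⟨b, by rw [h]; simp, ?_⟩
    have : tourLen ρ (a :: l) = pathLen ρ ((a :: l) ++ [a]) := by simp [tourLen]
    rw [this, h, List.append_assoc, List.cons_append, List.nil_append, pathLen_append,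
      pathLen_single]
    ring

/-- Potential of a string: its length plus boundary charges of its two ends. -/
def Psi (ρ : E → E → ℝ) (h : E → ℝ) (l : List E) : ℝ :=
  pathLen ρ l + l.head?.elim 0 h + l.getLast?.elim 0 h

/-- Total potential of a list of strings. -/
def Phi (ρ : E → E → ℝ) (h : E → ℝ) (S : List (List E)) : ℝ := (S.map (Psi ρ h)).sum

theorem Psi_merge (ρ : E → E → ℝ) (hs : ∀ a b, ρ a b = ρ b a) (h : E → ℝ) (δ : ℝ) (a b : E)
    (A B : List E) (hab : ρ a b ≤ h a + h b + δ) :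
    Psi ρ h ((a :: A).reverse ++ b :: B) ≤ Psi ρ h (a :: A) + Psi ρ h (b :: B) + δ := by
  have h1 : pathLen ρ ((a :: A).reverse ++ b :: B)
      = pathLen ρ (a :: A) + ρ a b + pathLen ρ (b :: B) := by
    rw [← pathLen_reverse ρ hs (a :: A)]
    simp only [List.reverse_cons, List.append_assoc, List.cons_append, List.nil_append]
    rw [pathLen_append]
  have h2 : ((a :: A).reverse ++ b :: B).head? = (a :: A).getLast? := by
    rw [List.head?_append, List.head?_reverse]
    simp [List.getLast?_cons]
  have h3 : ((a :: A).reverse ++ b :: B).getLast? = (b :: B).getLast? := by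
    rw [List.getLast?_append]
    simp [List.getLast?_cons]
  unfold Psi
  rw [h1, h2, h3]
  simp only [List.head?_cons, Option.elim_some]
  linarith

theorem exists_pair {α κ : Type*} (f : α → κ) (S : List α) (hS : ¬ (S.map f).Nodup) :
    ∃ A B S', S.Perm (A :: B :: S') ∧ f A = f B := by
  induction S with
  | nil => simp at hS
  | cons A S ih =>
    by_cases hA : f A ∈ S.map f
    · obtain ⟨B, hB, hfB⟩ := List.mem_map.1 hA
      obtain ⟨s, t, rfl⟩ := List.append_of_mem hB
      exact ⟨A, B, s ++ t, List.Perm.cons _ List.perm_middle, hfB.symm⟩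
    · have : ¬ (S.map f).Nodup := fun h => hS (by simpa using ⟨by simpa using hA, h⟩)
      obtain ⟨A', B', S', hp, hf⟩ := ih this
      refine ⟨A', B', A :: S', ?_, hf⟩
      refine (hp.cons A).trans ?_
      exact (List.Perm.swap _ _ _).trans ((List.Perm.swap _ _ _).cons _)

theorem reduce [Inhabited E] {κ : Type*} [Fintype κ] (ρ : E → E → ℝ) (hs : ∀ a b, ρ a b = ρ b a)
    (h : E → ℝ) (δ : ℝ) (hδ : 0 ≤ δ) (c : E → κ)
    (hc : ∀ a b, c a = c b → ρ a b ≤ h a + h b + δ) (n : ℕ) :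
    ∀ S : List (List E), S.length = n → (∀ l ∈ S, l ≠ []) →
    ∃ S' : List (List E), S'.flatten.Perm S.flatten ∧ (∀ l ∈ S', l ≠ []) ∧
      S'.length ≤ Fintype.card κ ∧ Phi ρ h S' ≤ Phi ρ h S + δ * n := by
  induction n with
  | zero =>
    intro S hS hne
    exact ⟨S, List.Perm.refl _, hne, by omega, by simp⟩
  | succ n ih =>
    intro S hS hne
    by_cases hcard : S.length ≤ Fintype.card κ
    · exact ⟨S, List.Perm.refl _, hne, hcard, by
        have : 0 ≤ δ * ((n + 1 : ℕ) : ℝ) := by positivity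
        linarith⟩
    · have hnd : ¬ (S.map (fun l => c l.headI)).Nodup := by
        intro hnd
        have := hnd.length_le_card
        rw [List.length_map] at this
        exact hcard this
      obtain ⟨A, B, S', hp, hf⟩ := exists_pair _ _ hnd
      have hA : A ≠ [] := hne A (hp.mem_iff.2 (by simp))
      have hB : B ≠ [] := hne B (hp.mem_iff.2 (by simp))
      obtain ⟨a, A, rfl⟩ := List.exists_cons_of_ne_nil hA
      obtain ⟨b, B, rfl⟩ := List.exists_cons_of_ne_nil hB
      have hl := hp.length_eq
      simp only [List.length_cons] at hl
      obtain ⟨S'', h1, h2, h3, h4⟩ := ih (((a :: A).reverse ++ b :: B) :: S')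
        (by simp only [List.length_cons]; omega) (by
          intro l hl
          rcases List.mem_cons.1 hl with rfl | hl
          · simp
          · exact hne l (hp.mem_iff.2 (by simp [hl])))
      refine ⟨S'', ?_, h2, h3, ?_⟩
      · refine h1.trans (List.Perm.trans ?_ hp.flatten.symm)
        simp only [List.flatten_cons]
        rw [← List.append_assoc]
        exact ((List.reverse_perm _).append_right _).append_right _
      · have hm := Psi_merge ρ hs h δ a b A B (hc a b hf)
        have hP : Phi ρ h S = Phi ρ h ((a :: A) :: (b :: B) :: S') :=
          (hp.map _).sum_eq
        rw [hP]
        refine h4.trans ?_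
        simp only [Phi, List.map_cons, List.sum_cons]
        push_cast
        linarith

theorem cut (ρ : E → E → ℝ) (h : E → ℝ) (l : List E) (a : E) :
    ∃ S : List (List E), S.flatten = a :: l ∧ (∀ s ∈ S, s ≠ []) ∧
      S.length ≤ (a :: l).length ∧
      Phi ρ h S ≤ pathLen (fun a b => min (ρ a b) (h a + h b)) (a :: l) + h a +
        (a :: l).getLast?.elim 0 h := by
  induction l generalizing a with
  | nil => exact ⟨[[a]], by simp, by simp, by simp, by simp [Phi, Psi, pathLen_single]⟩
  | cons b l ih =>
    obtain ⟨S, h1, h2, h3, h4⟩ := ih b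
    match S, h1, h2, h3, h4 with
    | [], h1, _, _, _ => simp at h1
    | [] :: S, _, h2, _, _ => simp at h2
    | (x :: u) :: S, h1, h2, h3, h4 =>
      have hx : x = b := by simp at h1; exact h1.1
      subst hx
      have hl : (a :: x :: l).getLast? = (x :: l).getLast? := by simp [List.getLast?_cons]
      rw [hl, pathLen_cons2]
      simp only [Phi, List.map_cons, List.sum_cons, Psi] at h4
      by_cases hab : ρ a x ≤ h a + h x
      · refine ⟨(a :: x :: u) :: S, by simpa using h1, ?_, by simp at h3 ⊢; omega, ?_⟩
        · intro s hs
          rcases List.mem_cons.1 hs with rfl | hs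
          · simp
          · exact h2 s (by simp [hs])
        · have hl : (a :: x :: u).getLast? = (x :: u).getLast? := by simp [List.getLast?_cons]
          simp only [Phi, List.map_cons, List.sum_cons, Psi, hl, pathLen_cons2]
          simp only [List.head?_cons, Option.elim_some, min_eq_left hab] at h4 ⊢
          linarith
      · refine ⟨[a] :: (x :: u) :: S, by simpa using h1, ?_, by simp at h3 ⊢; omega, ?_⟩
        · intro s hs
          rcases List.mem_cons.1 hs with rfl | hs
          · simp
          · exact h2 s hs
        · simp only [Phi, List.map_cons, List.sum_cons, Psi, pathLen_single,
            List.getLast?_singleton]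
          simp only [List.head?_cons, Option.elim_some, min_eq_right (not_le.1 hab).le] at h4 ⊢
          linarith

/-- Three-scale merging. -/
theorem merge3 [Inhabited E] {κ₀ κ₁ : Type*} [Fintype κ₀] [Fintype κ₁] (ρ : E → E → ℝ)
    (hs : ∀ a b, ρ a b = ρ b a) (h : E → ℝ) (hh : ∀ a, 0 ≤ h a)
    (δ₀ δ₁ D : ℝ) (hδ₀ : 0 ≤ δ₀) (hδ₁ : 0 ≤ δ₁) (hD : 0 ≤ D) (c₀ : E → κ₀) (c₁ : E → κ₁)
    (hc₀ : ∀ a b, c₀ a = c₀ b → ρ a b ≤ h a + h b + δ₀)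
    (hc₁ : ∀ a b, c₁ a = c₁ b → ρ a b ≤ h a + h b + δ₁)
    (hc : ∀ a b, ρ a b ≤ h a + h b + D) (l : List E) (hl : l ≠ []) (hD' : ∀ a ∈ l, h a ≤ D) :
    ∃ l' : List E, l'.Perm l ∧ pathLen ρ l' ≤
      pathLen (fun a b => min (ρ a b) (h a + h b)) l + 2 * D + δ₀ * l.length
        + δ₁ * Fintype.card κ₀ + D * Fintype.card κ₁ := by
  obtain ⟨a, l, rfl⟩ := List.exists_cons_of_ne_nil hl
  obtain ⟨S, h1, h2, h3, h4⟩ := cut ρ h l a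
  have hlast : (a :: l).getLast?.elim 0 h ≤ D := by
    rw [List.getLast?_eq_getLast_of_ne_nil hl]
    exact hD' _ (List.getLast_mem hl)
  obtain ⟨S0, p0, n0, m0, f0⟩ := reduce ρ hs h δ₀ hδ₀ c₀ hc₀ _ S rfl h2
  obtain ⟨S1, p1, n1, m1, f1⟩ := reduce ρ hs h δ₁ hδ₁ c₁ hc₁ _ S0 rfl n0
  obtain ⟨S2, p2, n2, m2, f2⟩ := reduce ρ hs h D hD (fun _ => ()) (fun a b _ => hc a b) _ S1 rfl n1
  have hp : S2.flatten.Perm (a :: l) := by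
    rw [← h1]; exact p2.trans (p1.trans p0)
  refine ⟨S2.flatten, hp, ?_⟩
  have hb : pathLen ρ S2.flatten ≤ Phi ρ h S2 := by
    match S2, m2 with
    | [], _ => simp [Phi, pathLen_nil]
    | [s], _ =>
      have e1 : 0 ≤ s.head?.elim 0 h := by cases s.head? <;> simp [hh]
      have e2 : 0 ≤ s.getLast?.elim 0 h := by cases s.getLast? <;> simp [hh]
      simp only [Phi, Psi, List.flatten_cons, List.flatten_nil, List.append_nil, List.map_cons,
        List.map_nil, List.sum_cons, List.sum_nil]
      linarith
    | _ :: _ :: _, m2 => simp at m2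
  have g0 : δ₀ * (S.length : ℝ) ≤ δ₀ * (a :: l).length := by
    gcongr
  have g1 : δ₁ * (S0.length : ℝ) ≤ δ₁ * Fintype.card κ₀ := by gcongr
  have g2 : D * (S1.length : ℝ) ≤ D * Fintype.card κ₁ := by gcongr
  have := hD' a (by simp)
  linarith

end combi

section geom

theorem cell_subset_box {d m : ℕ} (k : Fin d → Fin m) :
    cell m k ⊆ {x | ∀ i, x i ∈ Set.Icc ((k i : ℝ) / m) (((k i : ℝ) + 1) / m)} := by
  intro x hx i
  have := hx i
  split_ifs at this
  · exact this
  · exact Set.Ico_subset_Icc_self this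

theorem frontier_cell {d m : ℕ} (k : Fin d → Fin m) (p : EuclideanSpace ℝ (Fin d))
    (hp : p ∈ frontier (cell m k)) :
    (∀ i, p i ∈ Set.Icc ((k i : ℝ) / m) (((k i : ℝ) + 1) / m)) ∧
      ∃ i, p i = (k i : ℝ) / m ∨ p i = ((k i : ℝ) + 1) / m := by
  have hcl : IsClosed {x : EuclideanSpace ℝ (Fin d) |
      ∀ i, x i ∈ Set.Icc ((k i : ℝ) / m) (((k i : ℝ) + 1) / m)} := by
    simp only [Set.ofPred_forall]
    exact isClosed_iInter fun i => isClosed_Icc.preimage (by fun_prop)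
  have hop : IsOpen {x : EuclideanSpace ℝ (Fin d) |
      ∀ i, x i ∈ Set.Ioo ((k i : ℝ) / m) (((k i : ℝ) + 1) / m)} := by
    simp only [Set.ofPred_forall]
    exact isOpen_iInter_of_finite fun i => isOpen_Ioo.preimage (by fun_prop)
  have h1 := closure_minimal (cell_subset_box k) hcl hp.1
  refine ⟨h1, ?_⟩
  by_contra hcon
  push Not at hcon
  apply hp.2
  refine interior_maximal ?_ hop (fun i => ⟨lt_of_le_of_ne (h1 i).1 (hcon i).1.symm,
    lt_of_le_of_ne (h1 i).2 (hcon i).2⟩)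
  intro x hx i
  split_ifs
  · exact Set.Ioo_subset_Icc_self (hx i)
  · exact Set.Ioo_subset_Ico_self (hx i)

theorem dist_le_of_coord {d : ℕ} (x y : EuclideanSpace ℝ (Fin d)) (r : ℝ) (hr : 0 ≤ r)
    (h : ∀ i, |x i - y i| ≤ r) : dist x y ≤ d * r := by
  rw [EuclideanSpace.dist_eq]
  apply Real.sqrt_le_iff.2
  refine ⟨by positivity, ?_⟩
  calc ∑ i, dist (x i) (y i) ^ 2 ≤ ∑ i : Fin d, r ^ 2 := by
        apply Finset.sum_le_sum
        intro i _
        rw [Real.dist_eq]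
        have := h i
        gcongr
    _ = d * r ^ 2 := by simp
    _ ≤ (d * r) ^ 2 := by
        rw [mul_pow]
        have : (d : ℝ) ≤ (d : ℝ) ^ 2 := by exact_mod_cast Nat.le_self_pow (by norm_num) d
        gcongr

theorem box_abs_le {m : ℕ} (hm : 1 ≤ m) (c a b : ℝ)
    (ha : a ∈ Set.Icc (c / m) ((c + 1) / m)) (hb : b ∈ Set.Icc (c / m) ((c + 1) / m)) :
    |a - b| ≤ 1 := by
  have hm' : (1 : ℝ) ≤ m := by exact_mod_cast hm
  have : (c + 1) / m = c / m + 1 / m := by ring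
  have h1 : (1 : ℝ) / m ≤ 1 := by rw [div_le_one (by linarith)]; exact hm'
  obtain ⟨a1, a2⟩ := ha
  obtain ⟨b1, b2⟩ := hb
  rw [abs_le]; constructor <;> linarith

theorem code {n m : ℕ} (hm : 1 ≤ m) (k : Fin (n + 1) → Fin m) (q : ℕ) (hq : 1 ≤ q) :
    ∃ c : EuclideanSpace ℝ (Fin (n + 1)) → Fin (n + 1) × Bool × (Fin n → Fin (q + 1)),
      ∀ x ∈ frontier (cell m k), ∀ y ∈ frontier (cell m k), c x = c y →
        dist x y ≤ (n + 1) * (1 / q) := by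
  classical
  have hm0 : (0 : ℝ) < m := by exact_mod_cast hm
  have hm1 : (1 : ℝ) ≤ m := by exact_mod_cast hm
  have hq0 : (0 : ℝ) < q := by exact_mod_cast hq
  let fl : EuclideanSpace ℝ (Fin (n + 1)) → Fin (n + 1) → ℕ :=
    fun x j => ⌊(q : ℝ) * (m * x j - k j)⌋₊
  have hex : ∀ x ∈ frontier (cell m k), ∃ c : Fin (n + 1) × Bool × (Fin n → Fin (q + 1)),
      x c.1 = (k c.1 : ℝ) / m + (if c.2.1 then (1 : ℝ) / m else 0) ∧
      ∀ j, (c.2.2 j : ℕ) = fl x (c.1.succAbove j) := by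
    intro x hx
    obtain ⟨hb, i, hi⟩ := frontier_cell k x hx
    have hfl : ∀ j, fl x j < q + 1 := by
      intro j
      have h2 := (hb j).2
      rw [le_div_iff₀ hm0] at h2
      have : (q : ℝ) * (m * x j - k j) ≤ q := by nlinarith
      have := Nat.floor_le_floor this
      rw [Nat.floor_natCast] at this
      exact Nat.lt_succ_of_le this
    rcases hi with hi | hi
    · exact ⟨(i, false, fun j => ⟨fl x (i.succAbove j), hfl _⟩), by simpa using hi, fun j => rfl⟩
    · exact ⟨(i, true, fun j => ⟨fl x (i.succAbove j), hfl _⟩),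
        by simpa [add_div] using hi, fun j => rfl⟩
  choose! c hc1 hc2 using hex
  refine ⟨c, fun x hx y hy hxy => ?_⟩
  have := dist_le_of_coord x y (1 / q) (by positivity) ?_
  · push_cast at this; exact this
  intro i
  have hbx := (frontier_cell k x hx).1
  have hby := (frontier_cell k y hy).1
  rcases Fin.eq_self_or_eq_succAbove (c x).1 i with h | ⟨j, h⟩
  · have h1 := hc1 x hx
    have h2 := hc1 y hy
    rw [← hxy] at h2
    rw [h, h1, h2, sub_self, abs_zero]; positivity
  · have h1 := hc2 x hx j
    have h2 := hc2 y hy j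
    rw [← hxy, h1, ← h] at h2
    have n1 : 0 ≤ (q : ℝ) * (m * x i - k i) := by
      have := (hbx i).1
      rw [div_le_iff₀ hm0] at this
      apply mul_nonneg hq0.le; linarith
    have n2 : 0 ≤ (q : ℝ) * (m * y i - k i) := by
      have := (hby i).1
      rw [div_le_iff₀ hm0] at this
      apply mul_nonneg hq0.le; linarith
    have a1 := Nat.floor_le n1
    have a2 := Nat.floor_le n2
    have b1 := Nat.lt_floor_add_one ((q : ℝ) * (m * x i - k i))
    have b2 := Nat.lt_floor_add_one ((q : ℝ) * (m * y i - k i))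
    have h2' : ((⌊(q : ℝ) * (m * x i - k i)⌋₊ : ℕ) : ℝ) = (⌊(q : ℝ) * (m * y i - k i)⌋₊ : ℕ) := by
      exact_mod_cast h2
    rw [h2'] at a1 b1
    have hlt : |(q : ℝ) * (m * (x i - y i))| ≤ 1 := by
      rw [abs_le]; constructor <;> nlinarith
    rw [le_div_iff₀ hq0]
    rw [abs_mul, abs_mul, abs_of_pos hq0, abs_of_pos hm0] at hlt
    have : |x i - y i| ≤ m * |x i - y i| := le_mul_of_one_le_left (abs_nonneg _) hm1
    nlinarith

theorem enum_exists {E : Type*} (F : Set E) (hF : F.Finite) : ∃ l : List E, Enumerates l F :=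
  ⟨hF.toFinset.toList, Finset.nodup_toList _, by simp⟩

theorem enum_length {E : Type*} (F : Set E) (l : List E) (hl : Enumerates l F) :
    l.length = F.ncard := by
  classical
  have : F = (l.toFinset : Set E) := by ext z; simp [hl.2 z]
  rw [this, Set.ncard_coe_finset, List.toFinset_card_of_nodup hl.1]

theorem bdist_nonneg {E : Type*} [PseudoMetricSpace E] (R : Set E) (a b : E) :
    0 ≤ bdist R a b :=
  le_min dist_nonneg (add_nonneg Metric.infDist_nonneg Metric.infDist_nonneg)

theorem cell_ne_univ {n m : ℕ} (k : Fin (n + 1) → Fin m) : cell m k ≠ Set.univ := by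
  intro h
  have := cell_subset_box k (a := WithLp.toLp 2 (fun i => ((k i : ℝ) + 1) / m + 1))
    (by rw [h]; trivial) 0
  have := this.2
  simp at this
  linarith

theorem dist_cell {n m : ℕ} (hm : 1 ≤ m) (k : Fin (n + 1) → Fin m)
    (x y : EuclideanSpace ℝ (Fin (n + 1)))
    (hx : ∀ i, x i ∈ Set.Icc ((k i : ℝ) / m) (((k i : ℝ) + 1) / m))
    (hy : ∀ i, y i ∈ Set.Icc ((k i : ℝ) / m) (((k i : ℝ) + 1) / m)) :
    dist x y ≤ n + 1 := by
  have := dist_le_of_coord x y 1 zero_le_one (fun i => box_abs_le hm (k i) _ _ (hx i) (hy i))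
  simpa using this

theorem TB_le {n m : ℕ} (hm : 1 ≤ m) (k : Fin (n + 1) → Fin m)
    (X : Set (EuclideanSpace ℝ (Fin (n + 1)))) (hX : X.Finite) :
    TB X (cell m k) ≤ T (X ∩ cell m k) + (n + 1) := by
  rw [← sub_le_iff_le_add]
  obtain ⟨l0, hl0⟩ := enum_exists (X ∩ cell m k) (hX.inter_of_left _)
  refine le_csInf ⟨_, l0, hl0, rfl⟩ ?_
  rintro _ ⟨l, hl, rfl⟩
  rw [sub_le_iff_le_add]
  have h1 : TB X (cell m k) ≤ tourLen (bdist (cell m k)) l := by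
    refine csInf_le ⟨0, ?_⟩ ⟨l, hl, rfl⟩
    rintro _ ⟨l, hl, rfl⟩
    exact pathLen_nonneg _ (bdist_nonneg _) _
  refine h1.trans ?_
  cases l with
  | nil => simp [tourLen, pathLen_nil]; positivity
  | cons a l =>
    obtain ⟨b, hb, e⟩ := tourLen_cons (bdist (cell m k)) a l
    rw [e]
    have h2 : bdist (cell m k) b a ≤ n + 1 := (min_le_left _ _).trans
      (dist_cell hm k _ _ (cell_subset_box k ((hl.2 b).1 hb).2)
        (cell_subset_box k ((hl.2 a).1 (by simp)).2))
    have h3 := pathLen_mono (bdist (cell m k)) dist (fun a b => min_le_left _ _) (a :: l)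
    linarith

theorem T_le {n m : ℕ} (hm : 1 ≤ m) (k : Fin (n + 1) → Fin m)
    (X : Set (EuclideanSpace ℝ (Fin (n + 1)))) (hX : X.Finite) (N : ℕ) (hN : X.ncard ≤ N)
    (q₀ q₁ : ℕ) (hq₀ : 1 ≤ q₀) (hq₁ : 1 ≤ q₁) :
    T (X ∩ cell m k) ≤ TB X (cell m k) + (2 * (n + 1) + (n + 1) * (1 / q₀) * N
      + (n + 1) * (1 / q₁) * (2 * (n + 1) * (q₀ + 1) ^ n)
      + (n + 1) * (2 * (n + 1) * (q₁ + 1) ^ n) : ℝ) := by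
  rw [← sub_le_iff_le_add]
  obtain ⟨l0, hl0⟩ := enum_exists (X ∩ cell m k) (hX.inter_of_left _)
  refine le_csInf ⟨_, l0, hl0, rfl⟩ ?_
  rintro _ ⟨l, hl, rfl⟩
  rw [sub_le_iff_le_add]
  have hT : ∀ l', Enumerates l' (X ∩ cell m k) → T (X ∩ cell m k) ≤ pathLen dist l' := by
    intro l' hl'
    refine csInf_le ⟨0, ?_⟩ ⟨l', hl', rfl⟩
    rintro _ ⟨l, hl, rfl⟩
    exact pathLen_nonneg _ (fun _ _ => dist_nonneg) _
  by_cases hne : l = []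
  · subst hne
    refine (hT _ hl).trans ?_
    simp only [tourLen, pathLen_nil, List.take_nil, List.append_nil]
    positivity
  have hfne : (frontier (cell m k)).Nonempty := by
    obtain ⟨a, l, rfl⟩ := List.exists_cons_of_ne_nil hne
    exact nonempty_frontier_iff.2 ⟨⟨a, ((hl.2 a).1 (by simp)).2⟩, cell_ne_univ k⟩
  have hproj : ∀ x, ∃ y ∈ frontier (cell m k), Metric.infDist x (frontier (cell m k)) = dist x y :=
    fun x => isClosed_frontier.exists_infDist_eq_dist hfne x
  choose p hp hpd using hproj
  have htri : ∀ a b, dist a b ≤ Metric.infDist a (frontier (cell m k)) +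
      Metric.infDist b (frontier (cell m k)) + dist (p a) (p b) := by
    intro a b
    rw [hpd a, hpd b, dist_comm b (p b)]
    linarith [dist_triangle4 a (p a) (p b) b]
  obtain ⟨c₀, hc₀⟩ := code hm k q₀ hq₀
  obtain ⟨c₁, hc₁⟩ := code hm k q₁ hq₁
  obtain ⟨l', hperm, hlen⟩ := merge3 dist dist_comm
    (fun a => Metric.infDist a (frontier (cell m k))) (fun a => Metric.infDist_nonneg)
    ((n + 1) * (1 / q₀)) ((n + 1) * (1 / q₁)) (n + 1) (by positivity) (by positivity)
    (by positivity) (c₀ ∘ p) (c₁ ∘ p)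
    (fun a b hab => (htri a b).trans (by
      have := hc₀ _ (hp a) _ (hp b) hab
      linarith))
    (fun a b hab => (htri a b).trans (by
      have := hc₁ _ (hp a) _ (hp b) hab
      linarith))
    (fun a b => (htri a b).trans (by
      have := dist_cell hm k _ _ (frontier_cell k _ (hp a)).1 (frontier_cell k _ (hp b)).1
      linarith))
    l hne
    (fun a ha => by
      show Metric.infDist a (frontier (cell m k)) ≤ _
      rw [hpd a]
      exact dist_cell hm k _ _ (cell_subset_box k ((hl.2 a).1 ha).2) (frontier_cell k _ (hp a)).1)
  have hle : (l.length : ℝ) ≤ N := by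
    rw [enum_length _ l hl]
    exact_mod_cast (Set.ncard_le_ncard Set.inter_subset_left hX).trans hN
  have hen : Enumerates l' (X ∩ cell m k) :=
    ⟨hperm.nodup_iff.2 hl.1, fun z => hperm.mem_iff.trans (hl.2 z)⟩
  refine (hT l' hen).trans (hlen.trans ?_)
  have htour : pathLen (bdist (cell m k)) l ≤ tourLen (bdist (cell m k)) l := by
    obtain ⟨a, l, rfl⟩ := List.exists_cons_of_ne_nil hne
    obtain ⟨b, hb, e⟩ := tourLen_cons (bdist (cell m k)) a l
    rw [e]
    linarith [bdist_nonneg (cell m k) b a]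
  have hpl : pathLen (fun a b => min (dist a b) (Metric.infDist a (frontier (cell m k)) +
      Metric.infDist b (frontier (cell m k)))) l = pathLen (bdist (cell m k)) l := rfl
  rw [hpl]
  have hcard : ∀ q : ℕ, ((Fintype.card (Fin (n + 1) × Bool × (Fin n → Fin (q + 1))) : ℕ) : ℝ)
      = 2 * (n + 1) * (q + 1) ^ n := by
    intro q
    simp
    ring
  rw [hcard, hcard]
  have : ((n : ℝ) + 1) * (1 / q₀) * l.length ≤ ((n : ℝ) + 1) * (1 / q₀) * N := by gcongr
  linarith

end geom

theorem main_bound {n : ℕ} (hn : 1 ≤ n) (f : ℕ → ℝ)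
    (hlo : ∀ N, -(n + 1 : ℝ) ≤ f N)
    (hup : ∀ N q₀ q₁ : ℕ, 1 ≤ q₀ → 1 ≤ q₁ → f N ≤ (2 * (n + 1) + (n + 1) * (1 / q₀) * N
      + (n + 1) * (1 / q₁) * (2 * (n + 1) * (q₀ + 1) ^ n)
      + (n + 1) * (2 * (n + 1) * (q₁ + 1) ^ n) : ℝ)) :
    Filter.Tendsto (fun N : ℕ => f N / (N : ℝ) ^ ((n : ℝ) / (n + 1)))
      Filter.atTop (𝓝 0) := by
  have hn1 : (0 : ℝ) < n + 1 := by positivity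
  have hw : Filter.Tendsto (fun N : ℕ => (N : ℝ) ^ ((n : ℝ) / (n + 1))) atTop atTop :=
    (tendsto_rpow_atTop (by positivity)).comp tendsto_natCast_atTop_atTop
  rw [Metric.tendsto_atTop']
  intro ε hε
  obtain ⟨K, hK⟩ := exists_nat_gt (3 * (n + 1) / ε)
  have hK0 : (0 : ℝ) < K := lt_trans (by positivity) hK
  have hK1 : (1 : ℝ) ≤ K := by
    have : 0 < K := by exact_mod_cast hK0
    exact_mod_cast this
  set A : ℝ := (n + 1) * (2 * (n + 1) * (3 * K) ^ n) with hA
  have hA0 : 0 < A := by positivity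
  obtain ⟨q₁, hq₁⟩ := exists_nat_gt (3 * A / ε)
  have hq₁0 : (0 : ℝ) < q₁ := lt_trans (by positivity) hq₁
  have hq₁1 : 1 ≤ q₁ := by exact_mod_cast hq₁0
  set B : ℝ := 2 * (n + 1) + (n + 1) * (2 * (n + 1) * (q₁ + 1) ^ n) with hB
  obtain ⟨N₀, hN₀⟩ := (Filter.eventually_atTop.1 (hw.eventually_gt_atTop (3 * (B + n + 1) / ε)))
  refine ⟨max N₀ 1, fun N hN => ?_⟩
  have hNN : N₀ ≤ N := (le_max_left _ _).trans hN.le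
  have hN1 : 1 ≤ N := (le_max_right _ _).trans hN.le
  have hN1' : (1 : ℝ) ≤ N := by exact_mod_cast hN1
  have hbig := hN₀ N hNN
  set t : ℝ := (N : ℝ) ^ ((1 : ℝ) / (n + 1)) with ht
  have ht1 : 1 ≤ t := Real.one_le_rpow hN1' (by positivity)
  have hwt : (N : ℝ) ^ ((n : ℝ) / (n + 1)) = t ^ n := by
    rw [ht, ← Real.rpow_natCast, ← Real.rpow_mul (by positivity)]
    congr 1; ring
  have hNt : (N : ℝ) = t ^ n * t := by
    rw [← pow_succ, ht, ← Real.rpow_natCast, ← Real.rpow_mul (by positivity)]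
    push_cast
    rw [one_div, inv_mul_cancel₀ hn1.ne', Real.rpow_one]
  rw [hwt] at hbig ⊢
  set w := t ^ n with hwdef
  have hw0 : 0 < w := by positivity
  rw [Real.dist_eq, sub_zero, abs_div, abs_of_pos hw0, div_lt_iff₀ hw0]
  have hBw : B + n + 1 < ε / 3 * w := by
    rw [div_lt_iff₀ hε] at hbig; linarith
  have hB0 : 0 ≤ B := by positivity
  have hlo' := hlo N
  have hup' := hup N ⌈K * t⌉₊ q₁ (Nat.one_le_ceil_iff.2 (by positivity)) hq₁1
  have hc1 := Nat.le_ceil (K * t)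
  have hc2 := Nat.ceil_lt_add_one (a := K * t) (by positivity)
  have hKt : 1 ≤ K * t := by nlinarith
  set q : ℝ := (⌈K * t⌉₊ : ℝ) with hqd
  have e1 : ((n : ℝ) + 1) * (1 / q) * N ≤ ε / 3 * w := by
    have : (1 / q) * N ≤ w / K := by
      rw [one_div, inv_mul_le_iff₀ (by linarith), hNt]
      calc w * t = (K * t) * (w / K) := by field_simp
        _ ≤ q * (w / K) := by gcongr
    have h2 : ((n : ℝ) + 1) / K ≤ ε / 3 := by
      rw [div_lt_iff₀ hε] at hK
      rw [div_le_iff₀ hK0]; linarith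
    calc ((n : ℝ) + 1) * (1 / q) * N = (n + 1) * ((1 / q) * N) := by ring
      _ ≤ (n + 1) * (w / K) := by gcongr
      _ = (n + 1) / K * w := by ring
      _ ≤ _ := by gcongr
  have e2 : ((n : ℝ) + 1) * (1 / q₁) * (2 * (n + 1) * (q + 1) ^ n) ≤ ε / 3 * w := by
    have h3 : q + 1 ≤ 3 * K * t := by linarith
    have h2 : A / q₁ ≤ ε / 3 := by
      rw [div_lt_iff₀ hε] at hq₁
      rw [div_le_iff₀ hq₁0]; linarith
    calc ((n : ℝ) + 1) * (1 / q₁) * (2 * (n + 1) * (q + 1) ^ n)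
        ≤ ((n : ℝ) + 1) * (1 / q₁) * (2 * (n + 1) * (3 * K * t) ^ n) := by
          gcongr
      _ = A / q₁ * w := by rw [hA, hwdef, mul_pow]; ring
      _ ≤ _ := by gcongr
  rw [abs_lt]
  have : 0 < ε / 3 * w := by positivity
  constructor <;> linarith

/-- Fix `d ≥ 2`, an integer `m ≥ 1`, a subcube `ω_k` of the partition of `Ω = [0,1]^d` into
`m^d` congruent subcubes, and any sequence of finite sets `X_N ⊆ Ω` with `|X_N| ≤ N`.
Then the normalized difference between the TSP and the boundary TSP on the subcube
vanishes: `(T(X_N, ω_k) − T_B(X_N, ω_k)) / N^((d-1)/d) → 0` as `N → ∞`. -/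
theorem subcube_TSP_sub_boundaryTSP_tendsto_zero
    (d : ℕ) (hd : 2 ≤ d) (m : ℕ) (hm : 1 ≤ m) (k : Fin d → Fin m)
    (X : ℕ → Set (EuclideanSpace ℝ (Fin d)))
    (hXfin : ∀ N, (X N).Finite) (hXsub : ∀ N, X N ⊆ unitCube d)
    (hXcard : ∀ N, (X N).ncard ≤ N) :
    Filter.Tendsto
      (fun N => (T (X N ∩ cell m k) - TB (X N) (cell m k)) / (N : ℝ) ^ (((d:ℝ) - 1) / d))
      Filter.atTop (𝓝 0) := by
  obtain ⟨n, rfl⟩ : ∃ n, d = n + 1 := ⟨d - 1, by omega⟩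
  have := main_bound (n := n) (by omega)
    (fun N => T (X N ∩ cell m k) - TB (X N) (cell m k))
    (fun N => by have := TB_le hm k (X N) (hXfin N); linarith)
    (fun N q₀ q₁ h₀ h₁ => by
      have := T_le hm k (X N) (hXfin N) N (hXcard N) q₀ q₁ h₀ h₁
      linarith)
  convert this using 4
  push_cast
  ring

end
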